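/- For l, h ≥ 0 with N = l + h ≥ 2 and (l,h) ≠ (1,1), the starting position of the misère-play destined-coins game DM_{l,h} is a P-position if and only if N = 2, or N = 3 with all three coins of the same destiny (i.e., l = 0 or h = 0). In all other cases the first player wins: if both destinies are present, by weighing the counterfeit coin against a coin of the opposite destiny; if all coins share one destiny and N ≥ 4, by weighing two coins against two coins with the counterfeit among them. -/

import Mathlib

/-!
A model of the counterfeit-coin weighing games.

There are `n` coins, indexed by `Fin n`, exactly one of which is counterfeit;
all genuine coins weigh the same, and the counterfeit is lighter or heavier
than a genuine coin according to its `FakeType`.  Each coin carries a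
`CoinStatus` recording the Observer's knowledge about it:

* `excluded`: the Observer knows the coin is genuine;
* `light`   : destined to be lighter (if this coin is the counterfeit, it is lighter);
* `heavy`   : destined to be heavier (if this coin is the counterfeit, it is heavier);
* `unknown` : the coin could be the counterfeit, either lighter or heavier.

Both players know the counterfeit coin and its type, and alternately perform
weighings: two disjoint sets of coins of equal size are put on the two pans of a
balance scale, and the outcome is determined by the truth.  After a balanced
weighing, the coins on the scale become excluded.  After an unbalanced weighing,
the coins off the scale become excluded; a coin on the lighter pan becomes
light-destined unless this contradicts its previous status (a heavy-destined
coin on the lighter pan becomes excluded); symmetrically for the heavier pan;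
excluded coins stay excluded.  A weighing is legal iff the Observer gains some
new information, i.e. some coin changes status.

`Found P` says the Observer has found the counterfeit coin (exactly one coin is
not excluded); `FoundAndIdentified P` says she has moreover identified it as
lighter or heavier.  In the game whose end condition is a goal `goal`, play
stops as soon as the goal is reached (`GMove goal`).  `NormalWin` is the
normal-play winning predicate for the player to move (the player unable to move
loses, so the player making the last legal weighing wins); `MisereWin` is the
misère-play winning predicate (the player whose weighing reveals the full
information, i.e. moves to a goal position, loses); `grundy` is the Grundy
(nim-)value: the `mex` of the Grundy values of the options, a position without
options having Grundy value `0`.  Since every legal weighing strictly decreases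
the total hidden information `info P`, defining these by recursion with fuel
`info P` gives the correct values.
-/

/-- The Observer's knowledge about one coin. -/
inductive CoinStatus : Type
  | excluded : CoinStatus
  | light    : CoinStatus
  | heavy    : CoinStatus
  | unknown  : CoinStatus
  deriving DecidableEq

/-- Whether the counterfeit coin is actually lighter or heavier than a genuine coin. -/
inductive FakeType : Type
  | light : FakeType
  | heavy : FakeType
  deriving DecidableEq

/-- The destiny status corresponding to the true type of the counterfeit coin. -/
def FakeType.destiny : FakeType → CoinStatus
  | FakeType.light => CoinStatus.light
  | FakeType.heavy => CoinStatus.heavy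

/-- A position of the game: the statuses of the coins (the Observer's knowledge)
together with the identity and the true type of the counterfeit coin (which both
players know). -/
structure Position (n : ℕ) : Type where
  status : Fin n → CoinStatus
  counterfeit : Fin n
  fakeType : FakeType

/-- Possible outcomes of a weighing. -/
inductive Outcome : Type
  | balanced | leftLighter | rightLighter
  deriving DecidableEq

/-- The truthful outcome of weighing pan `A` (left) against pan `B` (right):
it is determined by the location and the type of the counterfeit coin. -/
def outcome {n : ℕ} (P : Position n) (A B : Finset (Fin n)) : Outcome :=
  if P.counterfeit ∈ A then
    (match P.fakeType with
      | FakeType.light => Outcome.leftLighter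
      | FakeType.heavy => Outcome.rightLighter)
  else if P.counterfeit ∈ B then
    (match P.fakeType with
      | FakeType.light => Outcome.rightLighter
      | FakeType.heavy => Outcome.leftLighter)
  else Outcome.balanced

/-- New status of a coin that lay on the lighter pan of an unbalanced weighing. -/
def onLighterPan : CoinStatus → CoinStatus
  | CoinStatus.excluded => CoinStatus.excluded
  | CoinStatus.heavy => CoinStatus.excluded
  | _ => CoinStatus.light

/-- New status of a coin that lay on the heavier pan of an unbalanced weighing. -/
def onHeavierPan : CoinStatus → CoinStatus
  | CoinStatus.excluded => CoinStatus.excluded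
  | CoinStatus.light => CoinStatus.excluded
  | _ => CoinStatus.heavy

/-- The statuses after weighing `A` against `B`. -/
def updateStatus {n : ℕ} (P : Position n) (A B : Finset (Fin n)) (i : Fin n) :
    CoinStatus :=
  match outcome P A B with
  | Outcome.balanced =>
      if i ∈ A ∨ i ∈ B then CoinStatus.excluded else P.status i
  | Outcome.leftLighter =>
      if i ∈ A then onLighterPan (P.status i)
      else if i ∈ B then onHeavierPan (P.status i)
      else CoinStatus.excluded
  | Outcome.rightLighter =>
      if i ∈ B then onLighterPan (P.status i)
      else if i ∈ A then onHeavierPan (P.status i)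
      else CoinStatus.excluded

/-- The position obtained from `P` by weighing pan `A` against pan `B`. -/
def weigh {n : ℕ} (P : Position n) (A B : Finset (Fin n)) : Position n :=
  ⟨updateStatus P A B, P.counterfeit, P.fakeType⟩

/-- `Move P Q`: `Q` is obtained from `P` by one legal weighing, i.e. the two
pans are disjoint and carry equally many coins, and the Observer gains some new
information (some coin changes status). -/
def Move {n : ℕ} (P Q : Position n) : Prop :=
  ∃ A B : Finset (Fin n), Disjoint A B ∧ A.card = B.card ∧
    updateStatus P A B ≠ P.status ∧ Q = weigh P A B

/-- The set of coins currently having status `s`. -/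
def statusSet {n : ℕ} (P : Position n) (s : CoinStatus) : Finset (Fin n) :=
  Finset.univ.filter fun i => P.status i = s

/-- The set of coins not yet known to be genuine. -/
def nonExcluded {n : ℕ} (P : Position n) : Finset (Fin n) :=
  Finset.univ.filter fun i => P.status i ≠ CoinStatus.excluded

/-- The number of unknown coins. -/
def unknownCount {n : ℕ} (P : Position n) : ℕ :=
  (statusSet P CoinStatus.unknown).card

/-- The number of destined coins. -/
def destinedCount {n : ℕ} (P : Position n) : ℕ :=
  (statusSet P CoinStatus.light).card + (statusSet P CoinStatus.heavy).card

/-- The number of coins sharing the counterfeit coin's status, counting the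
counterfeit coin itself. -/
def sameDestinyCount {n : ℕ} (P : Position n) : ℕ :=
  (Finset.univ.filter fun i => P.status i = P.status P.counterfeit).card

/-- The Observer has found the counterfeit coin: exactly one coin is not excluded. -/
def Found {n : ℕ} (P : Position n) : Prop := (nonExcluded P).card = 1

/-- The Observer has found the counterfeit coin and knows whether it is lighter
or heavier. -/
def FoundAndIdentified {n : ℕ} (P : Position n) : Prop :=
  Found P ∧ P.status P.counterfeit ≠ CoinStatus.unknown

/-- Moves in the game whose end condition is `goal`: the game stops as soon as
the Observer's goal is reached, so no further weighings happen after that. -/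
def GMove {n : ℕ} (goal : Position n → Prop) (P Q : Position n) : Prop :=
  ¬ goal P ∧ Move P Q

/-- The amount of information about one coin still hidden from the Observer. -/
def statusWeight : CoinStatus → ℕ
  | CoinStatus.excluded => 0
  | CoinStatus.unknown => 2
  | _ => 1

/-- The total information still hidden from the Observer.  Every legal weighing
strictly decreases it, so it bounds the number of remaining moves. -/
def info {n : ℕ} (P : Position n) : ℕ := ∑ i, statusWeight (P.status i)

/-- Normal-play winning predicate, computed with fuel. -/
def NormalWinAux {n : ℕ} (moveRel : Position n → Position n → Prop) :
    ℕ → Position n → Prop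
  | 0, _ => False
  | k + 1, P => ∃ Q, moveRel P Q ∧ ¬ NormalWinAux moveRel k Q

/-- The player to move wins under normal play: a player who has no legal move
loses (so the player making the last legal weighing wins).  The fuel `info P`
suffices since every legal weighing strictly decreases `info`. -/
def NormalWin {n : ℕ} (moveRel : Position n → Position n → Prop)
    (P : Position n) : Prop :=
  NormalWinAux moveRel (info P) P

/-- Misère-play winning predicate, computed with fuel. -/
def MisereWinAux {n : ℕ} (moveRel : Position n → Position n → Prop)
    (goal : Position n → Prop) : ℕ → Position n → Prop
  | 0, P => goal P
  | k + 1, P => goal P ∨ ∃ Q, moveRel P Q ∧ ¬ MisereWinAux moveRel goal k Q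

/-- The player to move wins under misère play: the player whose weighing
reveals the full information to the Observer (i.e. moves to a position
satisfying `goal`) loses; equivalently, the player to move at a goal position
has already won.  A position is a P-position iff `MisereWin` fails there. -/
def MisereWin {n : ℕ} (moveRel : Position n → Position n → Prop)
    (goal : Position n → Prop) (P : Position n) : Prop :=
  MisereWinAux moveRel goal (info P) P

/-- Minimum excludant of a set of naturals. -/
noncomputable def mex (s : Set ℕ) : ℕ := sInf {k : ℕ | k ∉ s}

/-- Grundy values, computed with fuel. -/
noncomputable def grundyAux {n : ℕ} (moveRel : Position n → Position n → Prop) :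
    ℕ → Position n → ℕ
  | 0, _ => 0
  | k + 1, P => mex {g : ℕ | ∃ Q, moveRel P Q ∧ grundyAux moveRel k Q = g}

/-- The Grundy (nim-)value of a position: the `mex` of the Grundy values of the
positions reachable in one legal move; a position with no legal move has Grundy
value `0`.  The fuel `info P` suffices since every legal weighing strictly
decreases `info`. -/
noncomputable def grundy {n : ℕ} (moveRel : Position n → Position n → Prop)
    (P : Position n) : ℕ :=
  grundyAux moveRel (info P) P

/-- Every coin has a destiny or is excluded, and the counterfeit coin's destiny is truthful. -/
def IsDestined {n : ℕ} (P : Position n) : Prop :=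
  (∀ i, P.status i ≠ CoinStatus.unknown) ∧ P.status P.counterfeit = P.fakeType.destiny

lemma updateStatus_eq_or_excluded {n : ℕ} {P : Position n} (hP : IsDestined P)
    (A B : Finset (Fin n)) (i : Fin n) :
    updateStatus P A B i = P.status i ∨ updateStatus P A B i = CoinStatus.excluded := by
  have h := hP.1 i
  unfold updateStatus
  cases outcome P A B <;> dsimp only <;> split_ifs <;> cases hs : P.status i <;>
    simp_all [onLighterPan, onHeavierPan]

lemma updateStatus_counterfeit {n : ℕ} {P : Position n} (hP : IsDestined P)
    {A B : Finset (Fin n)} (hAB : Disjoint A B) :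
    updateStatus P A B P.counterfeit = P.status P.counterfeit := by
  have h := hP.2
  by_cases hA : P.counterfeit ∈ A
  · have hB : P.counterfeit ∉ B := Finset.disjoint_left.mp hAB hA
    cases hf : P.fakeType <;> rw [hf] at h <;>
      simp [updateStatus, outcome, hA, hB, hf, h, FakeType.destiny, onLighterPan, onHeavierPan]
  · by_cases hB : P.counterfeit ∈ B <;> cases hf : P.fakeType <;> rw [hf] at h <;>
      simp [updateStatus, outcome, hA, hB, hf, h, FakeType.destiny, onLighterPan, onHeavierPan]

lemma IsDestined.weigh {n : ℕ} {P : Position n} (hP : IsDestined P)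
    {A B : Finset (Fin n)} (hAB : Disjoint A B) : IsDestined (weigh P A B) := by
  refine ⟨fun i => ?_, (updateStatus_counterfeit hP hAB).trans hP.2⟩
  change updateStatus P A B i ≠ _
  rcases updateStatus_eq_or_excluded hP A B i with h | h <;> rw [h]
  · exact hP.1 i
  · decide

lemma IsDestined.counterfeit_mem_nonExcluded {n : ℕ} {P : Position n} (hP : IsDestined P) :
    P.counterfeit ∈ nonExcluded P := by
  simp only [nonExcluded, Finset.mem_filter_univ, hP.2]
  cases P.fakeType <;> decide

/-- A legal weighing at a destined position shrinks the set of non-excluded coins. -/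
lemma nonExcluded_weigh_ssubset {n : ℕ} {P : Position n} (hP : IsDestined P)
    {A B : Finset (Fin n)} (hne : updateStatus P A B ≠ P.status) :
    nonExcluded (weigh P A B) ⊂ nonExcluded P := by
  obtain ⟨i, hi⟩ := Function.ne_iff.mp hne
  have hi' := (updateStatus_eq_or_excluded hP A B i).resolve_left hi
  refine (Finset.ssubset_iff_of_subset fun j hj => ?_).mpr ⟨i, ?_, ?_⟩
  · simp only [nonExcluded, Finset.mem_filter_univ] at hj ⊢
    change updateStatus P A B j ≠ _ at hj
    rwa [(updateStatus_eq_or_excluded hP A B j).resolve_right hj] at hj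
  · simp only [nonExcluded, Finset.mem_filter_univ]
    exact fun h => hi (hi'.trans h.symm)
  · simp only [nonExcluded, Finset.mem_filter_univ, not_not]
    exact hi'

lemma misereWinAux_of_goal {n : ℕ} {moveRel : Position n → Position n → Prop}
    {goal : Position n → Prop} {P : Position n} (h : goal P) (k : ℕ) :
    MisereWinAux moveRel goal k P := by
  cases k
  · exact h
  · exact Or.inl h

lemma not_misereWinAux_of_forall_found {n : ℕ} {P : Position n} (hP : ¬ Found P)
    (h : ∀ Q, Move P Q → Found Q) (k : ℕ) :
    ¬ MisereWinAux (GMove Found) Found k P := by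
  cases k with
  | zero => exact hP
  | succ k =>
    rintro (hF | ⟨Q, hQ, hk⟩)
    · exact hP hF
    · exact hk (misereWinAux_of_goal (h Q hQ.2) k)

/-- The player to move loses when exactly two coins are not excluded. -/
lemma not_misereWinAux_of_card_eq_two {n : ℕ} {P : Position n} (hP : IsDestined P)
    (h2 : (nonExcluded P).card = 2) (k : ℕ) :
    ¬ MisereWinAux (GMove Found) Found k P := by
  refine not_misereWinAux_of_forall_found (fun h => ?_) ?_ k
  · rw [Found] at h
    omega
  · rintro Q ⟨A, B, hAB, -, hne, rfl⟩
    have hlt := Finset.card_lt_card (nonExcluded_weigh_ssubset hP hne)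
    have hpos := Finset.card_pos.mpr ⟨_, (hP.weigh hAB).counterfeit_mem_nonExcluded⟩
    rw [Found]
    omega

/-- With three coins of the same destiny, every legal weighing reveals the counterfeit. -/
lemma found_of_move_of_three {P : Position 3} (hP : IsDestined P)
    (hs : ∀ i, P.status i = P.status P.counterfeit) {Q : Position 3} (hQ : Move P Q) :
    Found Q := by
  obtain ⟨A, B, hAB, hc, hne, rfl⟩ := hQ
  have hmem := (hP.weigh hAB).counterfeit_mem_nonExcluded
  refine Finset.card_eq_one.mpr ⟨P.counterfeit, Finset.eq_singleton_iff_unique_mem.mpr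
    ⟨hmem, fun i hi => ?_⟩⟩
  by_contra hic
  have hcard := Finset.card_union_of_disjoint hAB
  have hi' : updateStatus P A B i ≠ CoinStatus.excluded := by
    rw [nonExcluded, Finset.mem_filter_univ] at hi
    exact hi
  have h3 : (A ∪ B).card ≤ 3 := Finset.card_le_univ (A ∪ B)
  have hA1 : 0 < A.card := by
    by_contra h0
    have hA : A = ∅ := Finset.card_eq_zero.mp (by omega)
    have hB : B = ∅ := Finset.card_eq_zero.mp (by omega)
    subst hA hB
    exact hne (by funext j; simp [updateStatus, outcome])
  have hsi := (hs i).trans hP.2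
  by_cases hcA : P.counterfeit ∈ A
  · have hiA : i ∉ A := fun hiA => by
      have := Finset.one_lt_card.mpr ⟨i, hiA, P.counterfeit, hcA, hic⟩
      omega
    cases hf : P.fakeType <;> rw [hf] at hsi <;>
      simp [updateStatus, outcome, hcA, hiA, hf, hsi, FakeType.destiny,
        onLighterPan, onHeavierPan] at hi'
  · by_cases hcB : P.counterfeit ∈ B
    · have hiB : i ∉ B := fun hiB => by
        have := Finset.one_lt_card.mpr ⟨i, hiB, P.counterfeit, hcB, hic⟩
        omega
      cases hf : P.fakeType <;> rw [hf] at hsi <;>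
        simp [updateStatus, outcome, hcA, hcB, hiB, hf, hsi, FakeType.destiny,
          onLighterPan, onHeavierPan] at hi'
    · have hiAB : i ∉ A ∪ B := by
        intro h
        simp [updateStatus, outcome, hcA, hcB, Finset.mem_union.mp h] at hi'
      have hle : (insert i (insert P.counterfeit (A ∪ B))).card ≤ 3 := Finset.card_le_univ _
      rw [Finset.card_insert_of_notMem (by simp_all),
        Finset.card_insert_of_notMem (by simp_all)] at hle
      omega

/-- Weighing the counterfeit against a coin of the opposite destiny leaves just these two. -/
lemma nonExcluded_weigh_opposite {n : ℕ} {P : Position n}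
    (hd : ∀ i, P.status i = CoinStatus.light ∨ P.status i = CoinStatus.heavy)
    (hcf : P.status P.counterfeit = P.fakeType.destiny) {j : Fin n}
    (hj : P.status j ≠ P.status P.counterfeit) :
    nonExcluded (weigh P {P.counterfeit} {j}) = {P.counterfeit, j} := by
  ext i
  have hjd := hd j
  have hcj : P.counterfeit ≠ j := fun h => hj (by rw [h])
  by_cases hic : i = P.counterfeit
  · subst hic
    cases hf : P.fakeType <;> rw [hf] at hcf <;>
      simp [nonExcluded, weigh, updateStatus, outcome, hf, hcf, hcj, FakeType.destiny,
        onLighterPan, onHeavierPan]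
  · by_cases hij : i = j
    · subst hij
      cases hf : P.fakeType <;> rw [hf] at hcf <;> rcases hjd with hjd | hjd <;>
        simp_all [nonExcluded, weigh, updateStatus, outcome, FakeType.destiny,
          onLighterPan, onHeavierPan]
    · cases hf : P.fakeType <;>
        simp [nonExcluded, weigh, updateStatus, outcome, hf, hic, hij]

/-- With a single destiny, weighing two coins against two keeps the counterfeit's pan. -/
lemma nonExcluded_weigh_pairs {n : ℕ} {P : Position n}
    (hs : ∀ i, P.status i = P.status P.counterfeit)
    (hcf : P.status P.counterfeit = P.fakeType.destiny) {x y z : Fin n}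
    (hy : y ≠ P.counterfeit) (hz : z ≠ P.counterfeit) (hxy : x ≠ y) (hxz : x ≠ z) :
    nonExcluded (weigh P {P.counterfeit, x} {y, z}) = {P.counterfeit, x} := by
  ext i
  have hi := (hs i).trans hcf
  by_cases hiA : i = P.counterfeit ∨ i = x
  · have hiB : ¬ (i = y ∨ i = z) := by
      rcases hiA with rfl | rfl <;> simp [*, hy.symm, hz.symm]
    cases hf : P.fakeType <;> rw [hf] at hi <;>
      simp [nonExcluded, weigh, updateStatus, outcome, hf, hi, hiA, hiB, FakeType.destiny,
        onLighterPan, onHeavierPan]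
  · cases hf : P.fakeType <;> rw [hf] at hi <;>
      simp [nonExcluded, weigh, updateStatus, outcome, hf, hi, hiA, FakeType.destiny,
        onLighterPan, onHeavierPan]

/-- A weighing that leaves exactly two coins non-excluded, out of at least three, is legal
and winning. -/
lemma gMove_weigh_and_not_misereWinAux {n : ℕ} {P : Position n} (hP : IsDestined P)
    (h3 : 3 ≤ (nonExcluded P).card) {A B : Finset (Fin n)} (hAB : Disjoint A B)
    (hc : A.card = B.card) (h2 : (nonExcluded (weigh P A B)).card = 2) :
    GMove Found P (weigh P A B) ∧
      ∀ k, ¬ MisereWinAux (GMove Found) Found k (weigh P A B) := by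
  refine ⟨⟨fun h => ?_, A, B, hAB, hc, fun h => ?_, rfl⟩,
    not_misereWinAux_of_card_eq_two (hP.weigh hAB) h2⟩
  · rw [Found] at h
    omega
  · have : nonExcluded (weigh P A B) = nonExcluded P := by
      simp only [nonExcluded, weigh, h]
    rw [this] at h2
    omega

/-- For `l, h ≥ 0` with `N = l + h ≥ 2` and `(l,h) ≠ (1,1)`,
the starting position of the misère-play destined-coins game `DM_{l,h}` is a
P-position iff `N = 2`, or `N = 3` with all three coins of the same destiny
(`l = 0` or `h = 0`).  In all other cases the first player wins: if both
destinies are present, by weighing the counterfeit coin against a coin of the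
opposite destiny; if all coins share one destiny (and hence `N ≥ 4`), by
weighing two coins against two coins with the counterfeit among them. -/
theorem misereP_destined {n l h : ℕ} (P : Position n)
    (hN : 2 ≤ l + h) (hlh : ¬ (l = 1 ∧ h = 1))
    (hl : (statusSet P CoinStatus.light).card = l)
    (hh : (statusSet P CoinStatus.heavy).card = h)
    (hd : ∀ i, P.status i = CoinStatus.light ∨ P.status i = CoinStatus.heavy)
    (hcf : P.status P.counterfeit = P.fakeType.destiny) :
    (¬ MisereWin (GMove Found) Found P ↔
      (l + h = 2 ∨ (l + h = 3 ∧ (l = 0 ∨ h = 0)))) ∧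
    (¬ (l + h = 2 ∨ (l + h = 3 ∧ (l = 0 ∨ h = 0))) →
      ((1 ≤ l ∧ 1 ≤ h →
        ∀ j : Fin n, P.status j ≠ P.status P.counterfeit →
          GMove Found P (weigh P {P.counterfeit} {j}) ∧
          ¬ MisereWin (GMove Found) Found (weigh P {P.counterfeit} {j})) ∧
       ((l = 0 ∨ h = 0) →
        ∀ x y z : Fin n,
          x ≠ P.counterfeit → y ≠ P.counterfeit → z ≠ P.counterfeit →
          x ≠ y → x ≠ z → y ≠ z →
          GMove Found P (weigh P {P.counterfeit, x} {y, z}) ∧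
          ¬ MisereWin (GMove Found) Found (weigh P {P.counterfeit, x} {y, z})))) := by
  have hP : IsDestined P := ⟨fun i => by rcases hd i with h | h <;> rw [h] <;> decide, hcf⟩
  have huniv : nonExcluded P = Finset.univ := by
    ext i
    rcases hd i with h | h <;> simp [nonExcluded, h]
  have hcard : l + h = n := by
    rw [← hl, ← hh, statusSet, statusSet, ← Finset.card_union_of_disjoint]
    · rw [← Finset.filter_or, Finset.filter_true_of_mem fun i _ => hd i, Finset.card_univ,
        Fintype.card_fin]
    · refine Finset.disjoint_filter.mpr fun i _ h1 h2 => ?_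
      rw [h1] at h2
      cases h2
  have hne : (nonExcluded P).card = n := by rw [huniv, Finset.card_univ, Fintype.card_fin]
  have hinfo : info P = n := by
    have : ∀ i, statusWeight (P.status i) = 1 := fun i => by
      rcases hd i with h | h <;> rw [h] <;> rfl
    simp [info, this]
  have hsame : l = 0 ∨ h = 0 → ∀ i, P.status i = P.status P.counterfeit := by
    rintro (h0 | h0)
    · have h1 : ∀ i, P.status i = CoinStatus.heavy := fun i => (hd i).resolve_left fun hi => by
        have := Finset.card_pos.mpr ⟨i, show i ∈ statusSet P _ from by
          simpa [statusSet] using hi⟩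
        omega
      exact fun i => by rw [h1, h1]
    · have h1 : ∀ i, P.status i = CoinStatus.light := fun i => (hd i).resolve_right fun hi => by
        have := Finset.card_pos.mpr ⟨i, show i ∈ statusSet P _ from by
          simpa [statusSet] using hi⟩
        omega
      exact fun i => by rw [h1, h1]
  have hopp : 1 ≤ l ∧ 1 ≤ h → 3 ≤ n → ∀ j : Fin n, P.status j ≠ P.status P.counterfeit →
      GMove Found P (weigh P {P.counterfeit} {j}) ∧
        ∀ k, ¬ MisereWinAux (GMove Found) Found k (weigh P {P.counterfeit} {j}) := by
    intro _ h3 j hj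
    have hjc : P.counterfeit ≠ j := fun h => hj (by rw [h])
    refine gMove_weigh_and_not_misereWinAux hP (by omega) (by simpa using hjc) (by simp) ?_
    rw [nonExcluded_weigh_opposite hd hcf hj, Finset.card_pair hjc]
  have hpairs : l = 0 ∨ h = 0 → 3 ≤ n → ∀ x y z : Fin n,
      x ≠ P.counterfeit → y ≠ P.counterfeit → z ≠ P.counterfeit → x ≠ y → x ≠ z → y ≠ z →
      GMove Found P (weigh P {P.counterfeit, x} {y, z}) ∧
        ∀ k, ¬ MisereWinAux (GMove Found) Found k (weigh P {P.counterfeit, x} {y, z}) := by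
    intro h0 h3 x y z hx hy hz hxy hxz hyz
    refine gMove_weigh_and_not_misereWinAux hP (by omega) ?_ ?_ ?_
    · simp [hy, hz, hxy.symm, hxz.symm]
    · rw [Finset.card_pair hx.symm, Finset.card_pair hyz]
    · rw [nonExcluded_weigh_pairs (hsame h0) hcf hy hz hxy hxz, Finset.card_pair hx.symm]
  refine ⟨⟨fun hlose => ?_, fun hsmall => ?_⟩, fun hbig => ⟨fun hboth j hj => ?_,
    fun hone x y z hx hy hz hxy hxz hyz => ?_⟩⟩
  · by_contra hbig
    obtain ⟨m, rfl⟩ : ∃ m, n = m + 1 := ⟨n - 1, by omega⟩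
    refine hlose ?_
    rw [MisereWin, hinfo]
    by_cases h0 : l = 0 ∨ h = 0
    · have h4 : 3 < (Finset.univ.erase P.counterfeit).card + 1 := by
        rw [Finset.card_erase_of_mem (Finset.mem_univ _), Finset.card_univ, Fintype.card_fin]
        omega
      obtain ⟨x, y, z, hx, hy, hz, hxy, hxz, hyz⟩ :=
        Finset.two_lt_card_iff.mp (by omega : 2 < (Finset.univ.erase P.counterfeit).card)
      obtain ⟨hmove, hk⟩ := hpairs h0 (by omega) x y z (Finset.ne_of_mem_erase hx)
        (Finset.ne_of_mem_erase hy) (Finset.ne_of_mem_erase hz) hxy hxz hyz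
      exact Or.inr ⟨_, hmove, hk m⟩
    · obtain ⟨j, hj⟩ : ∃ j, P.status j ≠ P.status P.counterfeit := by
        obtain ⟨a, ha⟩ := Finset.card_pos.mp (by omega : 0 < (statusSet P .light).card)
        obtain ⟨b, hb⟩ := Finset.card_pos.mp (by omega : 0 < (statusSet P .heavy).card)
        simp only [statusSet, Finset.mem_filter_univ] at ha hb
        rcases hd P.counterfeit with hc | hc
        · exact ⟨b, by rw [hb, hc]; decide⟩
        · exact ⟨a, by rw [ha, hc]; decide⟩
      obtain ⟨hmove, hk⟩ := hopp (by omega) (by omega) j hj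
      exact Or.inr ⟨_, hmove, hk m⟩
  · rcases hsmall with h2 | ⟨h3, h0⟩
    · exact not_misereWinAux_of_card_eq_two hP (by omega) _
    · obtain rfl : n = 3 := by omega
      refine not_misereWinAux_of_forall_found (fun h => ?_)
        (fun Q hQ => found_of_move_of_three hP (hsame h0) hQ) _
      rw [Found] at h
      omega
  · exact (hopp hboth (by omega) j hj).imp_right fun hk => hk _
  · exact (hpairs hone (by omega) x y z hx hy hz hxy hxz hyz).imp_right fun hk => hk _
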